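/- Let G be a strictly chordal graph with at least two distinct minimal vertex separators and with τ(G) ≥ 1. Then sc(G) = max over all minimal vertex separators S of G of (ω(G−S) − |S|) (equivalently, max over mvs S of μ(S) + 1 − |S|), and any mvs attaining this maximum is a scattering set of G. -/

import Mathlib

open SimpleGraph

variable {V : Type*}

noncomputable def numComp (G : SimpleGraph V) (S : Set V) : ℕ :=
  Nat.card (G.induce Sᶜ).ConnectedComponent

def SeparatedBy (G : SimpleGraph V) (S : Set V) (u v : V) : Prop :=
  ∃ (hu : u ∈ Sᶜ) (hv : v ∈ Sᶜ), ¬ (G.induce Sᶜ).Reachable ⟨u, hu⟩ ⟨v, hv⟩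

def IsSeparator (G : SimpleGraph V) (S : Set V) : Prop :=
  ∃ u v, G.Reachable u v ∧ SeparatedBy G S u v

def IsMinimalSeparator (G : SimpleGraph V) (S : Set V) : Prop :=
  IsSeparator G S ∧ ∀ T ⊂ S, ¬ IsSeparator G T

def IsMVS (G : SimpleGraph V) (S : Set V) : Prop :=
  ∃ u v, u ≠ v ∧ ¬ G.Adj u v ∧ SeparatedBy G S u v ∧ ∀ T ⊂ S, ¬ SeparatedBy G T u v

def IsChordal (G : SimpleGraph V) : Prop :=
  ∀ n, 4 ≤ n → IsEmpty (cycleGraph n ↪g G)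

def StrictlyChordal (G : SimpleGraph V) : Prop :=
  G.Connected ∧ IsChordal G ∧
    ∀ S S' : Set V, IsMVS G S → IsMVS G S' → S ≠ S' → Disjoint S S'

noncomputable def sc [Finite V] (G : SimpleGraph V) : ℤ :=
  sSup {k : ℤ | ∃ S : Set V, numComp G S ≠ 1 ∧ k = (numComp G S : ℤ) - (Nat.card S : ℤ)}

noncomputable def toughness [Finite V] (G : SimpleGraph V) : ℝ :=
  sInf {t : ℝ | ∃ S : Set V, 1 < numComp G S ∧ t = (Nat.card S : ℝ) / (numComp G S : ℝ)}

def IsScatteringSet [Finite V] (G : SimpleGraph V) (S : Set V) : Prop :=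
  numComp G S ≠ 1 ∧ (numComp G S : ℤ) - (Nat.card S : ℤ) = sc G

def IsMaxClique (G : SimpleGraph V) (Q : Set V) : Prop :=
  G.IsClique Q ∧ ∀ R : Set V, G.IsClique R → Q ⊆ R → Q = R

def IsSimplicial (G : SimpleGraph V) (v : V) : Prop :=
  G.IsClique (G.neighborSet v)

def IsBoundaryClique (G : SimpleGraph V) (Q : Set V) : Prop :=
  IsMaxClique G Q ∧ (∃ v ∈ Q, IsSimplicial G v) ∧
    ∃ Q' : Set V, IsMaxClique G Q' ∧ Q' ≠ Q ∧ Q ∩ Q' = {v | v ∈ Q ∧ ¬ IsSimplicial G v}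

def BS (G : SimpleGraph V) (S : Set V) : Set (Set V) :=
  {Q | IsBoundaryClique G Q ∧ S ⊆ Q}

/-- `u` and `v` lie in the same component of `G - S`. -/
def ReachableOff (G : SimpleGraph V) (S : Set V) (u v : V) : Prop :=
  ∃ (hu : u ∈ Sᶜ) (hv : v ∈ Sᶜ), (G.induce Sᶜ).Reachable ⟨u, hu⟩ ⟨v, hv⟩

namespace ReachableOff

variable {G : SimpleGraph V} {S T : Set V} {u v w : V}

theorem refl (hu : u ∉ S) : ReachableOff G S u u := ⟨hu, hu, .refl _⟩

theorem symm (h : ReachableOff G S u v) : ReachableOff G S v u :=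
  ⟨h.2.1, h.1, h.2.2.symm⟩

theorem trans (h : ReachableOff G S u v) (h' : ReachableOff G S v w) : ReachableOff G S u w :=
  ⟨h.1, h'.2.1, h.2.2.trans h'.2.2⟩

theorem notMem_left (h : ReachableOff G S u v) : u ∉ S := h.1

theorem notMem_right (h : ReachableOff G S u v) : v ∉ S := h.2.1

theorem of_adj (hu : u ∉ S) (hv : v ∉ S) (h : G.Adj u v) : ReachableOff G S u v :=
  ⟨hu, hv, Adj.reachable (by simpa using h)⟩

theorem anti (hST : S ⊆ T) (h : ReachableOff G T u v) : ReachableOff G S u v := by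
  obtain ⟨hu, hv, h⟩ := h
  exact ⟨fun a => hu (hST a), fun a => hv (hST a),
    h.map (G.induceHomOfLE (Set.compl_subset_compl.2 hST)).toHom⟩

/-- A property of `u` that is preserved along edges of `G - S` holds on the component of `u`. -/
theorem induction {P : V → Prop} (h : ReachableOff G S u v) (hP : P u)
    (step : ∀ w w', P w → ReachableOff G S u w → G.Adj w w' → w' ∉ S → P w') : P v := by
  obtain ⟨hu, hv, h⟩ := h
  suffices H : ∀ z : ↥Sᶜ, (G.induce Sᶜ).Reachable ⟨u, hu⟩ z → P z from H _ h
  intro z hz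
  rw [reachable_iff_reflTransGen] at hz
  induction hz with
  | refl => exact hP
  | @tail b c hb hbc ih =>
    refine step b c ih ⟨hu, b.2, ?_⟩ (by simpa using hbc) c.2
    exact (reachable_iff_reflTransGen _ _).2 hb

end ReachableOff

section Separators

variable {G : SimpleGraph V} {S T : Set V} {u v w : V}

theorem separatedBy_iff :
    SeparatedBy G S u v ↔ u ∉ S ∧ v ∉ S ∧ ¬ ReachableOff G S u v := by
  constructor
  · rintro ⟨hu, hv, h⟩
    exact ⟨hu, hv, fun ⟨_, _, h'⟩ => h h'⟩
  · rintro ⟨hu, hv, h⟩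
    exact ⟨hu, hv, fun h' => h ⟨hu, hv, h'⟩⟩

theorem SeparatedBy.symm (h : SeparatedBy G S u v) : SeparatedBy G S v u := by
  rw [separatedBy_iff] at *
  exact ⟨h.2.1, h.1, fun h' => h.2.2 h'.symm⟩

theorem SeparatedBy.exists_isMVS [Finite V] (h : SeparatedBy G S u v) :
    ∃ T ⊆ S, IsMVS G T ∧ SeparatedBy G T u v := by
  obtain ⟨T, hTS, hT⟩ :=
    exists_minimal_le_of_wellFoundedLT (fun T : Set V => SeparatedBy G T u v) S h
  have hsep := separatedBy_iff.1 hT.1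
  refine ⟨T, hTS, ⟨u, v, ?_, ?_, hT.1, fun T' hT' hs => hT'.2 (hT.2 hs hT'.1)⟩, hT.1⟩
  · rintro rfl
    exact hsep.2.2 (.refl hsep.1)
  · exact fun hadj => hsep.2.2 (.of_adj hsep.1 hsep.2.1 hadj)

/-- Every vertex of a minimal `uv`-separator has a neighbour in the component of `u`. -/
theorem SeparatedBy.exists_adj (h : SeparatedBy G T u v)
    (hmin : ∀ T' ⊂ T, ¬ SeparatedBy G T' u v) {t : V} (ht : t ∈ T) :
    ∃ a, ReachableOff G T u a ∧ G.Adj t a := by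
  obtain ⟨hu, hv, hr⟩ := separatedBy_iff.1 h
  by_contra! hno
  have hsub : T \ {t} ⊂ T := ⟨Set.sdiff_subset, fun hh => (hh ht).2 rfl⟩
  have hreach : ReachableOff G (T \ {t}) u v := by
    by_contra hn
    exact hmin _ hsub (separatedBy_iff.2 ⟨fun a => hu a.1, fun a => hv a.1, hn⟩)
  refine hr (hreach.induction (.refl hu) fun w w' hw _ hadj hw' => ?_)
  by_cases hwt : w' = t
  · subst hwt
    exact absurd hadj.symm (hno w hw)
  · exact hw.trans (.of_adj hw.notMem_right (fun a => hw' ⟨a, hwt⟩) hadj)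

theorem exists_isGeodesic {x y : V} (h : G.Reachable x y) :
    ∃ (n : ℕ) (p : ℕ → V), p 0 = x ∧ p n = y ∧
      ∀ i ≤ n, ∀ j ≤ n, (p i = p j → i = j) ∧ (G.Adj (p i) (p j) ↔ i + 1 = j ∨ j + 1 = i) := by
  obtain ⟨p, hp⟩ := h.exists_walk_length_eq_dist
  have hd : ∀ i ≤ p.length, G.dist x (p.getVert i) = i := by
    intro i hi
    have := length_eq_dist_of_subwalk hp (p.isSubwalk_take i)
    rw [← this, Walk.take_length]
    omega
  refine ⟨p.length, p.getVert, by simp, by simp, fun i hi j hj => ⟨fun hij => ?_, ?_, ?_⟩⟩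
  · rw [← hd i hi, ← hd j hj, hij]
  · intro hadj
    have h1 := hadj.diff_dist_adj (u := x)
    rw [hd i hi, hd j hj] at h1
    have h2 : i ≠ j := by
      rintro rfl
      exact G.irrefl hadj
    omega
  · rintro (rfl | rfl)
    · exact p.adj_getVert_succ (by omega)
    · exact (p.adj_getVert_succ (by omega)).symm

/-- Two non-adjacent vertices outside of a component of `G - T`, each with a neighbour in it, are
joined by an induced path of length at least two with interior in that component. -/
theorem exists_induced_path {x y a b : V} (hne : x ≠ y) (hxy : ¬ G.Adj x y)
    (ha : ReachableOff G T u a) (hxa : G.Adj x a) (hb : ReachableOff G T u b) (hyb : G.Adj y b) :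
    ∃ (n : ℕ) (p : ℕ → V), 2 ≤ n ∧ p 0 = x ∧ p n = y ∧
      (∀ i, 0 < i → i < n → ReachableOff G T u (p i)) ∧
      ∀ i ≤ n, ∀ j ≤ n, (p i = p j → i = j) ∧ (G.Adj (p i) (p j) ↔ i + 1 = j ∨ j + 1 = i) := by
  let W : Set V := {w | w = x ∨ w = y ∨ ReachableOff G T u w}
  have hx : x ∈ W := Or.inl rfl
  have hy : y ∈ W := Or.inr (Or.inl rfl)
  have haW : a ∈ W := Or.inr (Or.inr ha)
  have hab : ∃ hbW : b ∈ W, (G.induce W).Reachable ⟨a, haW⟩ ⟨b, hbW⟩ := by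
    refine (ha.symm.trans hb).induction (P := fun b => ∃ hbW : b ∈ W,
      (G.induce W).Reachable ⟨a, haW⟩ ⟨b, hbW⟩) ⟨haW, .refl _⟩ ?_
    rintro w w' ⟨hw, hr⟩ haw hadj hw'
    have hw'W : w' ∈ W :=
      Or.inr (Or.inr ((ha.trans haw).trans (.of_adj haw.notMem_right hw' hadj)))
    exact ⟨hw'W, hr.trans (Adj.reachable (by simpa using hadj))⟩
  obtain ⟨hbW, hab⟩ := hab
  have hreach : (G.induce W).Reachable ⟨x, hx⟩ ⟨y, hy⟩ :=
    (Adj.reachable (by simpa using hxa)).trans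
      (hab.trans (Adj.reachable (by simpa using hyb.symm)))
  obtain ⟨n, p, h0, hn, hp⟩ := exists_isGeodesic hreach
  have hp' : ∀ i ≤ n, ∀ j ≤ n, ((p i : V) = p j → i = j) ∧
      (G.Adj (p i) (p j) ↔ i + 1 = j ∨ j + 1 = i) := by
    intro i hi j hj
    refine ⟨fun hij => (hp i hi j hj).1 (Subtype.ext hij), ?_⟩
    rw [← (hp i hi j hj).2]
    simp
  have h0' : (p 0 : V) = x := by rw [h0]
  have hn' : (p n : V) = y := by rw [hn]
  refine ⟨n, fun i => p i, ?_, h0', hn', ?_, hp'⟩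
  · by_contra! hlt
    interval_cases n
    · exact hne (h0'.symm.trans hn')
    · apply hxy
      rw [← h0', ← hn', (hp' 0 (by simp) 1 le_rfl).2]
      simp
  · intro i hi hin
    rcases (p i).2 with h | h | h
    · rw [← h0'] at h
      have := (hp' i hin.le 0 (by omega)).1 h
      omega
    · rw [← hn'] at h
      have := (hp' i hin.le n le_rfl).1 h
      omega
    · exact h

theorem cycleGraph_adj_of_lt {n : ℕ} {i j : Fin n} (hij : i < j) :
    (cycleGraph n).Adj i j ↔ i.val + 1 = j.val ∨ (i.val = 0 ∧ j.val + 1 = n) := by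
  have hi := i.2
  have hj := j.2
  have hij' : i.val < j.val := hij
  rw [cycleGraph_adj', Fin.coe_sub_iff_le.2 hij.le, Fin.coe_sub_iff_lt.2 hij]
  omega

/-- In a chordal graph, every minimal vertex separator is a clique. -/
theorem IsMVS.isClique (hG : IsChordal G) (hT : IsMVS G T) : G.IsClique T := by
  obtain ⟨u, v, -, -, hsep, hmin⟩ := hT
  have hmin' : ∀ T' ⊂ T, ¬ SeparatedBy G T' v u := fun T' hT' h => hmin T' hT' h.symm
  obtain ⟨-, -, hr⟩ := separatedBy_iff.1 hsep
  intro x hx y hy hne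
  by_contra hxy
  obtain ⟨a, ha, hxa⟩ := hsep.exists_adj hmin hx
  obtain ⟨b, hb, hyb⟩ := hsep.exists_adj hmin hy
  obtain ⟨a', ha', hxa'⟩ := hsep.symm.exists_adj hmin' hx
  obtain ⟨b', hb', hyb'⟩ := hsep.symm.exists_adj hmin' hy
  obtain ⟨m, p, hm, hp0, hpm, hpA, hp⟩ := exists_induced_path hne hxy ha hxa hb hyb
  obtain ⟨n, q, hn, hq0, hqn, hqB, hq⟩ :=
    exists_induced_path hne.symm (fun h => hxy h.symm) hb' hyb' ha' hxa'
  have hdisj : ∀ z z', ReachableOff G T u z → ReachableOff G T v z' →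
      z ≠ z' ∧ ¬ G.Adj z z' := by
    intro z z' hz hz'
    constructor
    · rintro rfl
      exact hr (hz.trans hz'.symm)
    · exact fun h =>
        hr ((hz.trans (.of_adj hz.notMem_right hz'.notMem_right h)).trans hz'.symm)
  let f : Fin (m + n) → V := fun i => if i.val < m then p i else q (i - m)
  have key : ∀ i j : Fin (m + n), i < j →
      f i ≠ f j ∧ (G.Adj (f i) (f j) ↔ (cycleGraph (m + n)).Adj i j) := by
    intro i j hij
    rw [cycleGraph_adj_of_lt hij]
    have hi := i.2
    have hj := j.2
    have hij' : i.val < j.val := hij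
    by_cases hjm : j.val < m
    · have him : i.val < m := by omega
      have hpij := hp i him.le j hjm.le
      simp only [f, him, hjm, if_true]
      exact ⟨fun h => by have := hpij.1 h; omega, by rw [hpij.2]; omega⟩
    · by_cases him : i.val < m
      · simp only [f, him, hjm, if_true, if_false]
        rcases Nat.eq_zero_or_pos i.val with hi0 | hi0
        · have hqij := hq n le_rfl (j - m) (by omega)
          rw [hi0, hp0, ← hqn]
          exact ⟨fun h => by have := hqij.1 h; omega, by rw [hqij.2]; omega⟩
        · rcases Nat.eq_zero_or_pos (j.val - m) with hj0 | hj0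
          · have hpij := hp i him.le m le_rfl
            rw [hj0, hq0, ← hpm]
            exact ⟨fun h => by have := hpij.1 h; omega, by rw [hpij.2]; omega⟩
          · have hd := hdisj _ _ (hpA i hi0 him) (hqB (j - m) hj0 (by omega))
            exact ⟨hd.1, iff_of_false hd.2 (by omega)⟩
      · have hqij := hq (i - m) (by omega) (j - m) (by omega)
        simp only [f, him, hjm, if_false]
        exact ⟨fun h => by have := hqij.1 h; omega, by rw [hqij.2]; omega⟩
  refine (hG (m + n) (by omega)).false ⟨⟨f, ?_⟩, ?_⟩
  · intro i j hij
    rcases lt_trichotomy i j with h | h | h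
    · exact absurd hij (key i j h).1
    · exact h
    · exact absurd hij.symm (key j i h).1
  · intro i j
    change G.Adj (f i) (f j) ↔ _
    rcases lt_trichotomy i j with h | rfl | h
    · exact (key i j h).2
    · simp
    · rw [G.adj_comm, (key j i h).2, adj_comm]

theorem reachableOff_empty_of_reachable (h : G.Reachable u v) : ReachableOff G ∅ u v := by
  rw [reachable_iff_reflTransGen] at h
  induction h with
  | refl => exact .refl (Set.notMem_empty _)
  | tail _ hbc ih => exact ih.trans (.of_adj (Set.notMem_empty _) (Set.notMem_empty _) hbc)

theorem IsMVS.nonempty (hG : G.Connected) (hT : IsMVS G T) : T.Nonempty := by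
  obtain ⟨u, v, -, -, hsep, -⟩ := hT
  rw [Set.nonempty_iff_ne_empty]
  rintro rfl
  exact (separatedBy_iff.1 hsep).2.2 (reachableOff_empty_of_reachable (hG u v))

theorem one_lt_numComp_iff [Finite V] :
    1 < numComp G S ↔ ∃ u v, SeparatedBy G S u v := by
  rw [numComp, Finite.one_lt_card_iff_nontrivial, nontrivial_iff]
  constructor
  · rintro ⟨c, d, hcd⟩
    induction c using ConnectedComponent.ind with | _ u
    induction d using ConnectedComponent.ind with | _ v
    exact ⟨u, v, u.2, v.2, fun h => hcd (ConnectedComponent.sound h)⟩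
  · rintro ⟨u, v, hu, hv, h⟩
    exact ⟨_, _, fun hcd => h (ConnectedComponent.exact hcd)⟩

theorem IsMVS.one_lt_numComp [Finite V] (hT : IsMVS G T) : 1 < numComp G T := by
  obtain ⟨u, v, -, -, hsep, -⟩ := hT
  exact one_lt_numComp_iff.2 ⟨u, v, hsep⟩

theorem numComp_union_add_one_le [Finite V] (hG : StrictlyChordal G) (hT : IsMVS G T)
    (hST : Disjoint S T) :
    numComp G (S ∪ T) + 1 ≤ numComp G S + numComp G T := by
  classical
  obtain ⟨t, ht⟩ := hT.nonempty hG.1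
  have hmem : ∀ {t}, t ∈ T → t ∉ S := fun h h' => Set.disjoint_left.1 hST h' h
  have hclique : ∀ t' ∈ T, ReachableOff G S t t' := by
    intro t' ht'
    by_cases h : t = t'
    · exact h ▸ .refl (hmem ht)
    · exact .of_adj (hmem ht) (hmem ht') (hT.isClique hG.2.1 ht ht' h)
  have hrep : ∀ c : (G.induce (S ∪ T)ᶜ).ConnectedComponent,
      ∃ w, (G.induce (S ∪ T)ᶜ).connectedComponentMk w = c := fun c => c.exists_rep
  choose w hw using hrep
  have hwS : ∀ c, (w c : V) ∈ Sᶜ := fun c h => (w c).2 (Or.inl h)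
  have hwT : ∀ c, (w c : V) ∈ Tᶜ := fun c h => (w c).2 (Or.inr h)
  have heq : ∀ c d, ReachableOff G (S ∪ T) (w c) (w d) → c = d := by
    rintro c d ⟨_, _, h⟩
    rw [← hw c, ← hw d]
    exact ConnectedComponent.sound h
  let f : Option (G.induce (S ∪ T)ᶜ).ConnectedComponent →
      (G.induce Sᶜ).ConnectedComponent ⊕ (G.induce Tᶜ).ConnectedComponent
    | none => Sum.inl ((G.induce Sᶜ).connectedComponentMk ⟨t, hmem ht⟩)
    | some c => if ReachableOff G S t (w c)
        then Sum.inr ((G.induce Tᶜ).connectedComponentMk ⟨w c, hwT c⟩)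
        else Sum.inl ((G.induce Sᶜ).connectedComponentMk ⟨w c, hwS c⟩)
  have hf : Function.Injective f := by
    have hnone : ∀ c, f none ≠ f (some c) := by
      intro c h
      by_cases hc : ReachableOff G S t (w c)
      · simp [f, hc] at h
      · simp only [f, hc, if_false, Sum.inl.injEq] at h
        exact hc ⟨_, _, ConnectedComponent.exact h⟩
    rintro (_ | c) (_ | d) h
    · rfl
    · exact absurd h (hnone d)
    · exact absurd h.symm (hnone c)
    · congr 1
      apply heq
      by_cases hc : ReachableOff G S t (w c) <;> by_cases hd : ReachableOff G S t (w d)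
      · simp only [f, hc, hd, if_true, Sum.inr.injEq] at h
        have hTr : ReachableOff G T (w c) (w d) := ⟨_, _, ConnectedComponent.exact h⟩
        by_contra hn
        obtain ⟨T', hT'sub, hT', hsep⟩ :=
          (separatedBy_iff.2 ⟨(w c).2, (w d).2, hn⟩).exists_isMVS
        by_cases hTT' : T' = T
        · subst hTT'
          exact (separatedBy_iff.1 hsep).2.2 hTr
        · have hT'S : T' ⊆ S := fun z hz => (hT'sub hz).resolve_right
            fun hz' => Set.disjoint_left.1 (hG.2.2 _ _ hT' hT hTT') hz hz'
          exact (separatedBy_iff.1 hsep).2.2 ((hc.symm.trans hd).anti hT'S)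
      · simp [f, hc, hd] at h
      · simp [f, hc, hd] at h
      · simp only [f, hc, hd, if_false, Sum.inl.injEq] at h
        have hSr : ReachableOff G S (w c) (w d) := ⟨_, _, ConnectedComponent.exact h⟩
        refine hSr.induction (.refl (w c).2) fun z z' hz hcz hadj hz' => ?_
        refine hz.trans (.of_adj hz.notMem_right ?_ hadj)
        rintro (h' | h')
        · exact hz' h'
        · exact hc ((hclique z' h').trans
            (hcz.trans (.of_adj hcz.notMem_right hz' hadj)).symm)
  have := Nat.card_le_card_of_injective f hf
  rwa [Finite.card_option, Nat.card_sum] at this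

theorem numComp_le_card_of_one_le_toughness [Finite V] (ht : 1 ≤ toughness G)
    (hS : 1 < numComp G S) : numComp G S ≤ Nat.card S := by
  have h0 : (0 : ℝ) < numComp G S := by exact_mod_cast (by omega : 0 < numComp G S)
  have hle : toughness G ≤ (Nat.card S : ℝ) / numComp G S := by
    refine csInf_le ⟨0, ?_⟩ ⟨S, hS, rfl⟩
    rintro _ ⟨S, -, rfl⟩
    positivity
  have := (one_le_div h0).1 (ht.trans hle)
  exact_mod_cast this

theorem exists_isMVS_numComp_sub_card_le [Finite V] (hG : StrictlyChordal G)
    (ht : 1 ≤ toughness G) (hS : 1 < numComp G S) :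
    ∃ T, IsMVS G T ∧
      (numComp G S : ℤ) - (Nat.card S : ℤ) ≤ (numComp G T : ℤ) - (Nat.card T : ℤ) := by
  induction hn : Nat.card S using Nat.strong_induction_on generalizing S with
  | _ n ih =>
    subst hn
    obtain ⟨u, v, hsep⟩ := one_lt_numComp_iff.1 hS
    obtain ⟨T, hTS, hT, -⟩ := hsep.exists_isMVS
    have hunion : S \ T ∪ T = S := Set.sdiff_union_of_subset hTS
    have hle := numComp_union_add_one_le hG hT (S := S \ T) Set.disjoint_sdiff_left
    rw [hunion] at hle
    have hcard : Nat.card ↥(S \ T) + Nat.card T = Nat.card S := by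
      simpa only [Nat.card_coe_set_eq] using Set.ncard_sdiff_add_ncard_of_subset hTS
    have hTt := numComp_le_card_of_one_le_toughness ht hT.one_lt_numComp
    have hT1 := hT.one_lt_numComp
    by_cases h1 : 1 < numComp G (S \ T)
    · obtain ⟨T', hT', hle'⟩ := ih _ (by omega) h1 rfl
      exact ⟨T', hT', by omega⟩
    · exact ⟨T, hT, by omega⟩

end Separators

theorem statement10 {V : Type*} [Finite V] (G : SimpleGraph V)
    (hsc : StrictlyChordal G)
    (h2 : ∃ S S' : Set V, IsMVS G S ∧ IsMVS G S' ∧ S ≠ S')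
    (ht : 1 ≤ toughness G) :
    IsGreatest {k : ℤ | ∃ S : Set V, IsMVS G S ∧
        k = (numComp G S : ℤ) - (Nat.card S : ℤ)} (sc G) ∧
    ∀ S : Set V, IsMVS G S →
      (numComp G S : ℤ) - (Nat.card S : ℤ) = sc G → IsScatteringSet G S := by
  refine ⟨?_, fun S hS h => ⟨hS.one_lt_numComp.ne', h⟩⟩
  obtain ⟨S₀, -, hS₀, -⟩ := h2
  obtain ⟨M, hM, hmax⟩ := Set.exists_max_image {S : Set V | IsMVS G S}
    (fun S => (numComp G S : ℤ) - (Nat.card S : ℤ)) (Set.toFinite _) ⟨S₀, hS₀⟩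
  have hsc_eq : sc G = (numComp G M : ℤ) - (Nat.card M : ℤ) := by
    refine IsGreatest.csSup_eq ⟨⟨M, (IsMVS.one_lt_numComp hM).ne', rfl⟩, ?_⟩
    rintro _ ⟨S, hS, rfl⟩
    rcases lt_or_gt_of_ne hS with h | h
    · have hempty : IsEmpty (G.induce Sᶜ).ConnectedComponent :=
        (Finite.card_eq_zero_iff).1 (by unfold numComp at h; omega)
      have hSM : Nat.card M ≤ Nat.card S := by
        have : S = Set.univ := Set.eq_univ_of_forall fun z => by
          by_contra hz
          exact hempty.false ((G.induce Sᶜ).connectedComponentMk ⟨z, hz⟩)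
        subst this
        exact Nat.card_mono (Set.toFinite _) (Set.subset_univ _)
      have := IsMVS.one_lt_numComp hM
      omega
    · obtain ⟨T, hT, hle⟩ := exists_isMVS_numComp_sub_card_le hsc ht h
      exact hle.trans (hmax T hT)
  rw [hsc_eq]
  refine ⟨⟨M, hM, rfl⟩, ?_⟩
  rintro _ ⟨S, hS, rfl⟩
  exact hmax S hS
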